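/- arXiv:2205.03470 — 7 statements merged into one kernel-verified Lean document; each statement's English description precedes it below -/
import Mathlib

section
/- Let O be a measurable space, P = {P_k}_{k∈K} a countable measurable partition of O, M a mechanism with output space O, and E : P → ℝ≥0 and Δ : P → ℝ≥0 functions such that M is (P_k, E(P_k), Δ(P_k))-subset differentially private for all k ∈ K. Then M is (P, E, Σ_{k∈K} Δ(P_k))-output differentially private. -/
open MeasureTheory
open scoped ENNReal NNReal

/-- A mechanism `M` is `(R,ε,δ)`-subset differentially private w.r.t. the neighboring
relation `N`: the DP inequality holds for all measurable subsets of `R`. -/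
def IsSubsetDP {D O : Type*} [MeasurableSpace O] (N : D → D → Prop) (M : D → Measure O)
    (R : Set O) (ε : ℝ≥0) (δ : ℝ≥0∞) : Prop :=
  ∀ x x', N x x' → ∀ S : Set O, S ⊆ R → MeasurableSet S →
    M x S ≤ ENNReal.ofReal (Real.exp ε) * M x' S + δ

/-- A mechanism `M` is `(P,E,δ)`-output differentially private w.r.t. the neighboring
relation `N`, for a countable partition `P` of the output space indexed by `K` and
`E : K → ℝ≥0` assigning a privacy level to each set of the partition. -/
def IsODP {D O K : Type*} [MeasurableSpace O] (N : D → D → Prop) (M : D → Measure O)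
    (P : K → Set O) (E : K → ℝ≥0) (δ : ℝ≥0∞) : Prop :=
  ∀ x x', N x x' → ∀ S : Set O, MeasurableSet S →
    M x S ≤ δ + ∑' k, ENNReal.ofReal (Real.exp (E k)) * M x' (S ∩ P k)

/-- if `M` is `(P_k, E(P_k), Δ(P_k))`-subset DP for every set `P_k` of a
countable measurable partition `P` of the output space, then `M` is
`(P, E, Σ_k Δ(P_k))`-ODP. -/
theorem subsetDP_implies_odp {D O K : Type*} [MeasurableSpace O] [Countable K]
    (N : D → D → Prop) (M : D → Measure O)
    [∀ x, IsProbabilityMeasure (M x)]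
    (P : K → Set O) (hPmeas : ∀ k, MeasurableSet (P k))
    (hPdisj : Pairwise (Function.onFun Disjoint P))
    (hPcover : ⋃ k, P k = Set.univ)
    (E : K → ℝ≥0) (Δ : K → ℝ≥0)
    (hSub : ∀ k, IsSubsetDP N M (P k) (E k) (Δ k)) :
    IsODP N M P E (∑' k, (Δ k : ℝ≥0∞)) := by
  intro x x' hN S hS
  calc M x S = M x (⋃ k, S ∩ P k) := by
        rw [← Set.inter_iUnion, hPcover, Set.inter_univ]
    _ ≤ ∑' k, M x (S ∩ P k) := measure_iUnion_le _
    _ ≤ ∑' k, ((Δ k : ℝ≥0∞) + ENNReal.ofReal (Real.exp (E k)) * M x' (S ∩ P k)) := by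
        refine ENNReal.tsum_le_tsum fun k => ?_
        rw [add_comm]
        exact hSub k x x' hN _ Set.inter_subset_right (hS.inter (hPmeas k))
    _ = _ := ENNReal.tsum_add
end

section
/- Let x^0 and x^1 be neighboring databases, let ε_t ≥ 0 and δ_t ≥ 0, and let M_1 be a ({P_k}_{k∈K}, E, δ)-output differentially private mechanism with output space O_1 such that E(P_k) ≤ ε_t for all k and δ ≤ δ_t. For each v ∈ O_1, let M_2^0(v) and M_2^1(v) be random variables with values in a measurable space O_2 (given by Markov kernels from O_1 to O_2) such that for all measurable V ⊆ O_2 and all v ∈ P_k, Pr(M_2^0(v) ∈ V) ≤ e^{ε_t − E(P_k)} · Pr(M_2^1(v) ∈ V) + δ_t − δ. Then for all measurable V ⊆ O_1 × O_2, Pr((M_1(x^0), M_2^0(M_1(x^0))) ∈ V) ≤ e^{ε_t} · Pr((M_1(x^1), M_2^1(M_1(x^1))) ∈ V) + δ_t, where in each pair both occurrences of M_1(x^b) denote the same random variable. -/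
open MeasureTheory ProbabilityTheory
open scoped ENNReal NNReal

theorem odp_layer {O : Type*} [MeasurableSpace O] (μ ν : Measure O) (δ : ℝ≥0∞)
    (h : ∀ S, MeasurableSet S → μ S ≤ δ + ν S) (f : O → ℝ≥0∞) (hf : Measurable f)
    (hf1 : ∀ v, f v ≤ 1) : ∫⁻ v, f v ∂μ ≤ δ + ∫⁻ v, f v ∂ν := by
  have hF : ∀ v, f v = ENNReal.ofReal (f v).toReal := fun v =>
    (ENNReal.ofReal_toReal (ne_top_of_le_ne_top ENNReal.one_ne_top (hf1 v))).symm
  have hm : Measurable fun v => (f v).toReal := hf.ennreal_toReal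
  have key : ∀ ρ : Measure O,
      ∫⁻ v, f v ∂ρ = ∫⁻ t in Set.Ioi (0:ℝ), ρ {a | t < (f a).toReal} := by
    intro ρ
    rw [lintegral_congr hF]
    exact lintegral_eq_lintegral_meas_lt ρ
      (Filter.Eventually.of_forall fun v => ENNReal.toReal_nonneg) hm.aemeasurable
  rw [key μ, key ν]
  calc ∫⁻ t in Set.Ioi (0:ℝ), μ {a | t < (f a).toReal}
      ≤ ∫⁻ t in Set.Ioi (0:ℝ), ((Set.Iic (1:ℝ)).indicator (fun _ => δ) t
          + ν {a | t < (f a).toReal}) := by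
        apply lintegral_mono
        intro t
        by_cases ht : t ≤ 1
        · simpa [Set.indicator, ht] using h _ (measurableSet_lt measurable_const hm)
        · have : {a | t < (f a).toReal} = ∅ := by
            ext a
            simp only [Set.mem_setOf_eq, Set.mem_empty_iff_false, iff_false, not_lt]
            have := ENNReal.toReal_mono ENNReal.one_ne_top (hf1 a)
            simp at this
            linarith
          simp [this]
    _ = δ + ∫⁻ t in Set.Ioi (0:ℝ), ν {a | t < (f a).toReal} := by
        rw [lintegral_add_left (measurable_const.indicator measurableSet_Iic)]
        congr 1
        rw [lintegral_indicator measurableSet_Iic, Measure.restrict_restrict measurableSet_Iic]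
        simp [Set.Iic_inter_Ioi]

/-- induction-step lemma: Let `x⁰, x¹` be neighboring databases and let
`M₁` be a `({P_k}, E, δ)`-ODP mechanism with `E(P_k) ≤ ε_t` for all `k` and `δ ≤ δ_t`.
If the Markov kernels `κ₀, κ₁` (playing the role of `v ↦ M₂⁰(v)` and `v ↦ M₂¹(v)`)
satisfy, for all `v ∈ P_k` and measurable `V ⊆ O₂`,
`κ₀ v V ≤ e^{ε_t − E(P_k)} κ₁ v V + (δ_t − δ)`, then the joint distributions of
`(M₁(x⁰), M₂⁰(M₁(x⁰)))` and `(M₁(x¹), M₂¹(M₁(x¹)))` satisfy the `(ε_t, δ_t)`-DP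
inequality on every measurable `V ⊆ O₁ × O₂`. -/
theorem odp_induction_step {D O₁ O₂ K : Type*}
    [MeasurableSpace O₁] [MeasurableSpace O₂] [Countable K]
    (N : D → D → Prop) (x0 x1 : D) (hN : N x0 x1)
    (εt : ℝ≥0) (δt : ℝ≥0∞) (δ : ℝ≥0∞) (hδ : δ ≤ δt)
    (P : K → Set O₁) (hPmeas : ∀ k, MeasurableSet (P k))
    (hPdisj : Pairwise (Function.onFun Disjoint P))
    (hPcover : ⋃ k, P k = Set.univ)
    (E : K → ℝ≥0) (hE : ∀ k, E k ≤ εt)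
    (M₁ : D → Measure O₁) [∀ x, IsProbabilityMeasure (M₁ x)]
    (hODP : IsODP N M₁ P E δ)
    (κ₀ κ₁ : Kernel O₁ O₂) [IsMarkovKernel κ₀] [IsMarkovKernel κ₁]
    (hκ : ∀ k, ∀ v ∈ P k, ∀ V : Set O₂, MeasurableSet V →
      κ₀ v V ≤ ENNReal.ofReal (Real.exp ((εt : ℝ) - (E k : ℝ))) * κ₁ v V + (δt - δ))
    (V : Set (O₁ × O₂)) (hV : MeasurableSet V) :
    (M₁ x0).compProd κ₀ V ≤
      ENNReal.ofReal (Real.exp εt) * (M₁ x1).compProd κ₁ V + δt := by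
  classical
  have hex : ∀ v, ∃ k, v ∈ P k := fun v => by
    have : v ∈ ⋃ k, P k := hPcover ▸ Set.mem_univ v
    simpa using this
  choose idx hidx using hex
  have huniq : ∀ k v, v ∈ P k → idx v = k := by
    intro k v hv
    by_contra hne
    exact Set.disjoint_left.1 (hPdisj hne) (hidx v) hv
  letI : MeasurableSpace K := ⊤
  have hidxm : Measurable idx := by
    apply measurable_to_countable'
    intro k
    have : idx ⁻¹' {k} = P k := by
      ext v
      constructor
      · rintro rfl
        exact hidx v
      · exact huniq k v
    rw [this]
    exact hPmeas k
  have hcomp : ∀ φ : K → ℝ≥0∞, Measurable fun v => φ (idx v) := fun φ =>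
    (measurable_from_top (f := φ)).comp hidxm
  set e : O₁ → ℝ≥0∞ := fun v => ENNReal.ofReal (Real.exp (E (idx v))) with he
  have hem : Measurable e := hcomp fun k => ENNReal.ofReal (Real.exp (E k))
  set c : O₁ → ℝ≥0∞ := fun v => ENNReal.ofReal (Real.exp ((εt : ℝ) - (E (idx v) : ℝ))) with hc
  have hcm : Measurable c := hcomp fun k => ENNReal.ofReal (Real.exp ((εt : ℝ) - (E k : ℝ)))
  have hec : ∀ v, e v * c v = ENNReal.ofReal (Real.exp εt) := by
    intro v
    simp only [he, hc]
    rw [← ENNReal.ofReal_mul (Real.exp_nonneg _), ← Real.exp_add]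
    congr 2
    ring
  have hgm : Measurable fun v => κ₁ v (Prod.mk v ⁻¹' V) :=
    Kernel.measurable_kernel_prodMk_left hV
  have hODP' : ∀ S, MeasurableSet S → M₁ x0 S ≤ δ + (M₁ x1).withDensity e S := by
    intro S hS
    refine (hODP x0 x1 hN S hS).trans_eq ?_
    congr 1
    have hSU : S = ⋃ k, S ∩ P k := by rw [← Set.inter_iUnion, hPcover, Set.inter_univ]
    conv_rhs => rw [hSU]
    rw [measure_iUnion (fun i j hij => (hPdisj hij).mono Set.inter_subset_right
      Set.inter_subset_right) (fun k => hS.inter (hPmeas k))]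
    congr 1
    ext k
    rw [withDensity_apply _ (hS.inter (hPmeas k)),
      setLIntegral_congr_fun (g := fun _ => ENNReal.ofReal (Real.exp (E k)))
        (hS.inter (hPmeas k)) (fun v hv => by simp only [he, huniq k v hv.2])]
    simp
  set h : O₁ → ℝ≥0∞ := fun v => min 1 (c v * κ₁ v (Prod.mk v ⁻¹' V)) with hh
  have hhm : Measurable h := measurable_const.min (hcm.mul hgm)
  rw [Measure.compProd_apply hV, Measure.compProd_apply hV]
  calc ∫⁻ v, κ₀ v (Prod.mk v ⁻¹' V) ∂(M₁ x0)
      ≤ ∫⁻ v, (h v + (δt - δ)) ∂(M₁ x0) := by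
        apply lintegral_mono
        intro v
        have h1 := hκ (idx v) v (hidx v) _ (measurable_prodMk_left (x := v) hV)
        have h2 : κ₀ v (Prod.mk v ⁻¹' V) ≤ 1 := prob_le_one
        simp only [hh]
        rw [min_add]
        exact le_min (h2.trans le_self_add) h1
    _ = ∫⁻ v, h v ∂(M₁ x0) + (δt - δ) := by
        rw [lintegral_add_left hhm]
        simp
    _ ≤ (δ + ∫⁻ v, h v ∂((M₁ x1).withDensity e)) + (δt - δ) := by
        gcongr
        exact odp_layer _ _ δ hODP' h hhm fun v => min_le_left _ _
    _ = ∫⁻ v, e v * h v ∂(M₁ x1) + δt := by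
        rw [lintegral_withDensity_eq_lintegral_mul _ hem hhm, add_comm δ, add_assoc,
          add_tsub_cancel_of_le hδ]
        rfl
    _ ≤ ∫⁻ v, ENNReal.ofReal (Real.exp εt) * κ₁ v (Prod.mk v ⁻¹' V) ∂(M₁ x1) + δt := by
        refine add_le_add (lintegral_mono fun v => ?_) le_rfl
        rw [← hec v, mul_assoc]
        refine mul_le_mul_right ?_ _
        exact min_le_right _ _
    _ = _ := by rw [lintegral_const_mul _ hgm]
end

section
/- Let M_SVT be the Sparse Vector Technique mechanism with threshold noise ρ ∼ Lap(Δ/ε_1), per-query noise ν_i ∼ Lap(2cΔ/ε_2), queries of sensitivity at most Δ, and cutoff c. For each integer c' ∈ [0,c], let S^SVT_{c'} be the set of output sequences of M_SVT containing exactly c' entries equal to ⊤, let P = {S^SVT_{c'}}_{c'=0}^{c}, and let E(S^SVT_{c'}) = ε_1 + (c'/c)·ε_2. Then M_SVT is (P, E, 0)-output differentially private; in particular, for any pair of neighboring databases x, x' and any finite output sequence a ∈ {⊥,⊤}^l containing exactly c' ≤ c entries equal to ⊤, Pr(M_SVT(x) = a) ≤ e^{ε_1 + (c'/c)ε_2}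 · Pr(M_SVT(x') = a). -/
open MeasureTheory
open scoped ENNReal NNReal Classical

/-- Lists over a type are given the discrete σ-algebra. -/
instance listMeasurableSpace {α : Type*} : MeasurableSpace (List α) := ⊤

/-- The centered Laplace distribution with scale `b`,
with density `z ↦ (1/(2b)) exp(−|z|/b)` w.r.t. Lebesgue measure. -/
noncomputable def laplace (b : ℝ) : Measure ℝ :=
  volume.withDensity fun z => ENNReal.ofReal ((2 * b)⁻¹ * Real.exp (-|z| / b))

/-- The probability that, given threshold noise `ρ = z`, the `i`-th answer of the
Sparse Vector Technique equals `a.getD i false` (where `⊤ = true`, `⊥ = false`):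
the data analyst's (possibly adaptive) stream is `Q`, mapping the previous answers
to the next query/threshold pair (or `none` for STOP); per-query noise is
`Lap(2cΔ/ε₂)`. -/
noncomputable def svtStep {D : Type*} (x : D) (Q : List Bool → Option ((D → ℝ) × ℝ))
    (ε₂ Δ : ℝ) (c : ℕ) (z : ℝ) (a : List Bool) (i : ℕ) : ℝ≥0∞ :=
  match Q (a.take i) with
  | none => 0
  | some (q, T) =>
      if a.getD i false then laplace (2 * c * Δ / ε₂) {ν | T + z ≤ q x + ν}
      else laplace (2 * c * Δ / ε₂) {ν | q x + ν < T + z}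

/-- The probability that the Sparse Vector Technique `M_SVT(x, Q, Δ, T₁, T₂, …, c)`
(threshold noise `ρ ∼ Lap(Δ/ε₁)`, per-query noise `ν_i ∼ Lap(2cΔ/ε₂)`, cutoff `c`)
outputs exactly the answer sequence `a`: the run must be consistent (before every
step, fewer than `c` ⊤-answers were produced and the stream had not stopped, and
after the last step the stream stops or the cutoff is reached), and the probability
is the integral over the threshold noise of the product of the per-step comparison
probabilities. -/
noncomputable def svtProb {D : Type*} (x : D) (Q : List Bool → Option ((D → ℝ) × ℝ))
    (ε₁ ε₂ Δ : ℝ) (c : ℕ) (a : List Bool) : ℝ≥0∞ :=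
  if (∀ j < a.length, (a.take j).count true < c ∧ Q (a.take j) ≠ none)
      ∧ (c ≤ a.count true ∨ Q a = none) then
    ∫⁻ z, ∏ i ∈ Finset.range a.length, svtStep x Q ε₂ Δ c z a i ∂(laplace (Δ / ε₁))
  else 0

/-- The output distribution of the Sparse Vector Technique on the database `x`,
a measure on the (countable) space of answer sequences. -/
noncomputable def svtMeasure {D : Type*} (x : D) (Q : List Bool → Option ((D → ℝ) × ℝ))
    (ε₁ ε₂ Δ : ℝ) (c : ℕ) : Measure (List Bool) :=
  Measure.sum fun a : List Bool => svtProb x Q ε₁ ε₂ Δ c a • Measure.dirac a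

theorem svtaux_shift (b t : ℝ) (hb : 0 < b) (g : ℝ → ℝ≥0∞) :
    ∫⁻ z, g z ∂(laplace b) ≤
      ENNReal.ofReal (Real.exp (|t| / b)) * ∫⁻ z, g (z - t) ∂(laplace b) := by
  have hm : Measurable fun z : ℝ => ENNReal.ofReal ((2 * b)⁻¹ * Real.exp (-|z| / b)) := by
    fun_prop
  have key : ∀ h : ℝ → ℝ≥0∞, ∫⁻ z, h z ∂(laplace b) =
      ∫⁻ z, ENNReal.ofReal ((2 * b)⁻¹ * Real.exp (-|z| / b)) * h z := by
    intro h
    unfold laplace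
    rw [lintegral_withDensity_eq_lintegral_mul_non_measurable _ hm
      (Filter.Eventually.of_forall fun _ => ENNReal.ofReal_lt_top)]
    rfl
  rw [key, key, ← lintegral_add_right_eq_self
    (fun z => ENNReal.ofReal ((2 * b)⁻¹ * Real.exp (-|z| / b)) * g (z - t)) t,
    ← lintegral_const_mul' _ _ ENNReal.ofReal_ne_top]
  refine lintegral_mono fun z => ?_
  simp only [add_sub_cancel_right]
  rw [← mul_assoc, ← ENNReal.ofReal_mul (Real.exp_nonneg _)]
  refine mul_le_mul_left (ENNReal.ofReal_le_ofReal ?_) _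
  have : Real.exp (-|z| / b) ≤ Real.exp (|t| / b) * Real.exp (-|z + t| / b) := by
    rw [← Real.exp_add, Real.exp_le_exp, ← add_div]
    gcongr
    linarith [abs_add_le z t]
  calc _ ≤ (2 * b)⁻¹ * (Real.exp (|t| / b) * Real.exp (-|z + t| / b)) := by gcongr
    _ = _ := by ring

theorem svtaux_shift_set (b t : ℝ) (hb : 0 < b) (A : Set ℝ) (hA : MeasurableSet A) :
    laplace b A ≤ ENNReal.ofReal (Real.exp (|t| / b)) * laplace b {z | z - t ∈ A} := by
  have h := svtaux_shift b t hb (A.indicator 1)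
  have hB : MeasurableSet {z : ℝ | z - t ∈ A} := (measurable_id.sub_const t) hA
  rw [lintegral_indicator_one hA] at h
  have e : (fun z : ℝ => A.indicator (1 : ℝ → ℝ≥0∞) (z - t)) =
      ({z : ℝ | z - t ∈ A} : Set ℝ).indicator 1 := by
    ext z; simp [Set.indicator]
  rw [e, lintegral_indicator_one hB] at h
  exact h

theorem svtaux_prod (K : ℝ≥0∞) (a : List Bool) :
    ∏ i ∈ Finset.range a.length, (if a.getD i false then K else 1) = K ^ a.count true := by
  induction a with
  | nil => simp
  | cons b l ih =>
    rw [List.length_cons, Finset.prod_range_succ']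
    simp only [List.getD_cons_succ, List.getD_cons_zero]
    rw [ih]
    cases b <;> simp [pow_succ]

theorem svtaux_step {D : Type*} (Q : List Bool → Option ((D → ℝ) × ℝ))
    (Δ ε₂ : ℝ) (hΔ : 0 < Δ) (hε₂ : 0 < ε₂) (c : ℕ) (hc : 1 ≤ c) (x x' : D)
    (hs : ∀ hist q T, Q hist = some (q, T) → |q x - q x'| ≤ Δ) (z : ℝ) (a : List Bool) (i : ℕ) :
    svtStep x Q ε₂ Δ c z a i ≤
      (if a.getD i false then ENNReal.ofReal (Real.exp (ε₂ / c)) else 1) *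
        svtStep x' Q ε₂ Δ c (z + Δ) a i := by
  have hc' : (0 : ℝ) < c := by exact_mod_cast hc
  unfold svtStep
  rcases hq : Q (a.take i) with _ | ⟨q, T⟩
  · simp
  · have hab := abs_le.1 (hs _ _ _ hq)
    simp only
    split_ifs with h
    · have hm : MeasurableSet {ν : ℝ | T + z ≤ q x + ν} :=
        measurableSet_le measurable_const (by fun_prop)
      refine (svtaux_shift_set _ (2 * Δ) (by positivity) _ hm).trans ?_
      have e : |2 * Δ| / (2 * c * Δ / ε₂) = ε₂ / c := by
        rw [abs_of_pos (by positivity)]; field_simp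
      rw [e]
      gcongr
      intro hν
      simp only [Set.mem_ofPred_eq] at *
      linarith
    · rw [one_mul]
      apply measure_mono
      intro ν hν
      simp only [Set.mem_ofPred_eq] at *
      linarith

theorem svtaux_prob {D : Type*} (Q : List Bool → Option ((D → ℝ) × ℝ))
    (Δ ε₁ ε₂ : ℝ) (hΔ : 0 < Δ) (hε₁ : 0 < ε₁) (hε₂ : 0 < ε₂) (c : ℕ) (hc : 1 ≤ c) (x x' : D)
    (hs : ∀ hist q T, Q hist = some (q, T) → |q x - q x'| ≤ Δ) (a : List Bool) :
    svtProb x Q ε₁ ε₂ Δ c a ≤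
        ENNReal.ofReal (Real.exp (ε₁ + (a.count true : ℝ) / c * ε₂)) *
          svtProb x' Q ε₁ ε₂ Δ c a := by
  unfold svtProb
  split_ifs with h
  swap
  · simp
  refine (svtaux_shift _ Δ (by positivity) _).trans ?_
  have e : |Δ| / (Δ / ε₁) = ε₁ := by
    rw [abs_of_pos hΔ]; field_simp
  rw [e, Real.exp_add, ENNReal.ofReal_mul (Real.exp_nonneg _), mul_assoc]
  gcongr
  rw [← lintegral_const_mul' _ _ ENNReal.ofReal_ne_top]
  refine lintegral_mono fun z => ?_
  refine (Finset.prod_le_prod' fun i _ =>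
    svtaux_step Q Δ ε₂ hΔ hε₂ c hc x x' hs (z - Δ) a i).trans ?_
  rw [Finset.prod_mul_distrib, svtaux_prod, sub_add_cancel,
    ← ENNReal.ofReal_pow (Real.exp_nonneg _), ← Real.exp_nat_mul]
  apply le_of_eq
  congr 3
  ring

theorem svtaux_zero {D : Type*} (Q : List Bool → Option ((D → ℝ) × ℝ))
    (Δ ε₁ ε₂ : ℝ) (c : ℕ) (x : D) (a : List Bool) (ha : c < a.count true) :
    svtProb x Q ε₁ ε₂ Δ c a = 0 := by
  unfold svtProb
  rw [if_neg]
  rintro ⟨h, -⟩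
  rcases List.eq_nil_or_concat a with rfl | ⟨l, b, rfl⟩
  · simp at ha
  · have := (h l.length (by simp)).1
    simp [List.count_append] at this ha
    have h2 : List.count true [b] ≤ 1 := List.count_le_length
    omega

theorem svtaux_meas {D : Type*} (Q : List Bool → Option ((D → ℝ) × ℝ))
    (Δ ε₁ ε₂ : ℝ) (c : ℕ) (x : D) (S : Set (List Bool)) :
    svtMeasure x Q ε₁ ε₂ Δ c S =
      ∑' a, svtProb x Q ε₁ ε₂ Δ c a * S.indicator 1 a := by
  have hS : MeasurableSet S := trivial
  unfold svtMeasure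
  rw [Measure.sum_apply _ hS]
  simp [Measure.dirac_apply' _ hS]

/-- `M_SVT` is `(P, E, 0)`-ODP for the partition
`P = {S^SVT_{c'}}_{c'=0}^c` of its range by the number `c'` of ⊤-answers, with
`E(S^SVT_{c'}) = ε₁ + (c'/c)·ε₂`; in particular, for every pair of neighboring
databases and every output sequence `a` with `c' ≤ c` ⊤-entries,
`Pr(M_SVT(x) = a) ≤ e^{ε₁ + (c'/c)ε₂} Pr(M_SVT(x') = a)`. -/
theorem svt_odp {D : Type*} (N : D → D → Prop)
    (Q : List Bool → Option ((D → ℝ) × ℝ))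
    (Δ ε₁ ε₂ : ℝ) (hΔ : 0 < Δ) (hε₁ : 0 < ε₁) (hε₂ : 0 < ε₂)
    (c : ℕ) (hc : 1 ≤ c)
    (hsens : ∀ hist q T, Q hist = some (q, T) → ∀ x x', N x x' → |q x - q x'| ≤ Δ) :
    (∀ x x', N x x' → ∀ S : Set (List Bool),
      svtMeasure x Q ε₁ ε₂ Δ c S ≤ 0 +
        ∑ c' ∈ Finset.range (c + 1),
          ENNReal.ofReal (Real.exp (ε₁ + (c' : ℝ) / c * ε₂)) *
            svtMeasure x' Q ε₁ ε₂ Δ c (S ∩ {a | a.count true = c'})) ∧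
    (∀ x x', N x x' → ∀ a : List Bool, a.count true ≤ c →
      svtProb x Q ε₁ ε₂ Δ c a ≤
        ENNReal.ofReal (Real.exp (ε₁ + (a.count true : ℝ) / c * ε₂)) *
          svtProb x' Q ε₁ ε₂ Δ c a) := by
  have hp := fun x x' (h : N x x') => svtaux_prob Q Δ ε₁ ε₂ hΔ hε₁ hε₂ c hc x x'
    (fun hist q T hq => hsens hist q T hq x x' h)
  refine ⟨fun x x' h S => ?_, fun x x' h a _ => hp x x' h a⟩
  rw [zero_add]
  simp only [svtaux_meas, ← ENNReal.tsum_mul_left]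
  rw [← Summable.tsum_finsetSum (fun _ _ => ENNReal.summable)]
  refine ENNReal.tsum_le_tsum fun a => ?_
  by_cases haS : a ∈ S
  swap
  · simp [haS]
  by_cases hca : a.count true ≤ c
  swap
  · simp [svtaux_zero Q Δ ε₁ ε₂ c x a (not_le.1 hca)]
  refine le_trans ?_ (Finset.single_le_sum (fun _ _ => zero_le)
    (Finset.mem_range.2 (Nat.lt_succ_of_le hca)))
  simpa [haS] using hp x x' h a
end

section
/- Let Δ > 0, c ≥ 1, ε_2 > 0, and let ν be a random variable with the centered Laplace distribution of scale 2cΔ/ε_2. Then for all real numbers u, u' with |u − u'| ≤ Δ and all real numbers t, it holds that Pr(u + ν ≥ t − Δ) ≤ e^{ε_2/c} · Pr(u' + ν ≥ t). -/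
open MeasureTheory
open scoped ENNReal NNReal

/-- for `ν ∼ Lap(2cΔ/ε₂)` and `|u − u'| ≤ Δ`,
`Pr(u + ν ≥ t − Δ) ≤ e^{ε₂/c} · Pr(u' + ν ≥ t)`. -/
theorem laplace_shift_bound (Δ : ℝ) (hΔ : 0 < Δ) (c : ℕ) (hc : 1 ≤ c)
    (ε₂ : ℝ) (hε₂ : 0 < ε₂) (u u' t : ℝ) (h : |u - u'| ≤ Δ) :
    laplace (2 * c * Δ / ε₂) {z | t - Δ ≤ u + z} ≤
      ENNReal.ofReal (Real.exp (ε₂ / c)) * laplace (2 * c * Δ / ε₂) {z | t ≤ u' + z} := by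
  have hc' : (0 : ℝ) < c := by exact_mod_cast hc
  obtain ⟨b, hb⟩ : ∃ b, b = 2 * c * Δ / ε₂ := ⟨_, rfl⟩
  have hb0 : 0 < b := by rw [hb]; positivity
  have hbe : 2 * Δ / b = ε₂ / c := by rw [hb]; field_simp
  rw [← hb, ← hbe]
  have hA : MeasurableSet {z : ℝ | t - Δ ≤ u + z} :=
    measurableSet_le measurable_const (measurable_const.add measurable_id)
  have hB : MeasurableSet {z : ℝ | t ≤ u' + z} :=
    measurableSet_le measurable_const (measurable_const.add measurable_id)
  unfold laplace
  rw [withDensity_apply _ hA, withDensity_apply _ hB, ← lintegral_indicator hA,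
    ← lintegral_indicator hB,
    ← lintegral_sub_right_eq_self _ (u - u' + Δ),
    ← lintegral_const_mul' _ _ ENNReal.ofReal_ne_top]
  refine lintegral_mono fun w => ?_
  by_cases hw : t ≤ u' + w
  · have hw' : w - (u - u' + Δ) ∈ {z : ℝ | t - Δ ≤ u + z} := by
      simp only [Set.mem_setOf_eq]; linarith
    have hw2 : w ∈ {z : ℝ | t ≤ u' + z} := hw
    rw [Set.indicator_of_mem hw', Set.indicator_of_mem hw2,
      ← ENNReal.ofReal_mul (Real.exp_pos _).le]
    apply ENNReal.ofReal_le_ofReal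
    rw [mul_left_comm, ← Real.exp_add, ← add_div]
    have h1 : -|w - (u - u' + Δ)| ≤ 2 * Δ + -|w| := by
      have h2 := abs_sub_abs_le_abs_sub w (w - (u - u' + Δ))
      have h3 : |w - (w - (u - u' + Δ))| ≤ 2 * Δ := by
        rw [sub_sub_cancel]
        obtain ⟨h4, h5⟩ := abs_le.mp h
        rw [abs_le]; constructor <;> linarith
      linarith
    gcongr
  · have hw' : w - (u - u' + Δ) ∉ {z : ℝ | t - Δ ≤ u + z} := by
      simp only [Set.mem_setOf_eq]; intro h6; apply hw; linarith
    rw [Set.indicator_of_notMem hw']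
    exact zero_le
end

section
/- Let T be an (ε,δ)-PTR function and let s ∈ C be fixed. Then the mechanism x ↦ T(x, s) is (2ε, δ)-differentially private. -/
open MeasureTheory
open scoped ENNReal NNReal

/-- The σ-algebra on `Option α`: a set is measurable iff its preimage under `some`
is measurable (in particular `{none}` is measurable). -/
instance optionMeasurableSpace {α : Type*} [m : MeasurableSpace α] :
    MeasurableSpace (Option α) := m.map some

/-- A mechanism `M` is `(ε,δ)`-differentially private w.r.t. the neighboring
relation `N`. -/
def IsDP {D O : Type*} [MeasurableSpace O] (N : D → D → Prop) (M : D → Measure O)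
    (ε : ℝ) (δ : ℝ≥0∞) : Prop :=
  ∀ x x', N x x' → ∀ S : Set O, MeasurableSet S →
    M x S ≤ ENNReal.ofReal (Real.exp ε) * M x' S + δ

/-- `T : D × (C ∪ {⊥}) → C' ∪ {⊥}` (randomized, `⊥ = none`) is an `(ε,δ)`-PTR
function with good sets `G`. -/
structure IsPTR {D C C' : Type*} [MeasurableSpace C']
    (N : D → D → Prop) (T : D → Option C → Measure (Option C'))
    (ε : ℝ) (δ : ℝ≥0∞) (G : D → Set C) : Prop where
  /-- `T(·,·)` is a randomized function, i.e. each `T(x,s)` is a probability measure. -/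
  prob : ∀ x s, IsProbabilityMeasure (T x s)
  /-- (1) `Pr(T(x,⊥) = ⊥) = 1` for all `x`. -/
  bot : ∀ x, T x none {none} = 1
  /-- (2a) `Pr(T(x,s) = ⊥) ≤ e^ε Pr(T(x',s) = ⊥)` for neighboring `x, x'`. -/
  dp_bot : ∀ s x x', N x x' →
    T x (some s) {none} ≤ ENNReal.ofReal (Real.exp ε) * T x' (some s) {none}
  /-- (2b) `Pr(T(x,s) ≠ ⊥) ≤ e^ε Pr(T(x',s) ≠ ⊥)` for neighboring `x, x'`. -/
  dp_not_bot : ∀ s x x', N x x' →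
    T x (some s) {none}ᶜ ≤ ENNReal.ofReal (Real.exp ε) * T x' (some s) {none}ᶜ
  /-- (3) if `s ∈ G x` then `Pr(T(x,s) ∈ C'') ≤ e^{2ε} Pr(T(x',s) ∈ C'')` for all
  neighboring `x'` and measurable `C'' ⊆ C'`. -/
  good : ∀ x s, s ∈ G x → ∀ x', N x x' → ∀ C'' : Set C', MeasurableSet C'' →
    T x (some s) (some '' C'') ≤
      ENNReal.ofReal (Real.exp (2 * ε)) * T x' (some s) (some '' C'')
  /-- (4) if `s ∉ G x` then `Pr(T(x,s) ≠ ⊥) ≤ δ`. -/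
  bad : ∀ x s, s ∉ G x → T x (some s) {none}ᶜ ≤ δ

/-- for an `(ε,δ)`-PTR function `T` and a fixed `s ∈ C`,
the mechanism `x ↦ T(x,s)` is `(2ε,δ)`-differentially private. -/
theorem ptr_is_dp {D C C' : Type*} [MeasurableSpace C']
    (N : D → D → Prop) (hsymm : ∀ x x', N x x' → N x' x)
    (T : D → Option C → Measure (Option C'))
    (ε : ℝ) (hε : 0 ≤ ε) (δ : ℝ≥0∞) (G : D → Set C)
    (hT : IsPTR N T ε δ G) (s : C) :
    IsDP N (fun x => T x (some s)) (2 * ε) δ := by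
  intro x x' hN S hS
  show T x (some s) S ≤ ENNReal.ofReal (Real.exp (2 * ε)) * T x' (some s) S + δ
  have hn : MeasurableSet ({none} : Set (Option C')) := by
    change MeasurableSet (some ⁻¹' ({none} : Set (Option C')))
    have h : (some ⁻¹' ({none} : Set (Option C'))) = ∅ := by ext; simp
    rw [h]
    exact MeasurableSet.empty
  have hP : MeasurableSet (some ⁻¹' S) := hS
  have hdiff : S \ {none} = some '' (some ⁻¹' S) := by
    ext o
    cases o <;> simp
  have hexp : ENNReal.ofReal (Real.exp ε) ≤ ENNReal.ofReal (Real.exp (2 * ε)) :=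
    ENNReal.ofReal_le_ofReal (Real.exp_le_exp.mpr (by linarith))
  have hbot : T x (some s) (S ∩ {none}) ≤
      ENNReal.ofReal (Real.exp (2 * ε)) * T x' (some s) (S ∩ {none}) := by
    by_cases h : none ∈ S
    · have h1 : S ∩ {none} = {none} :=
        Set.inter_eq_right.mpr (Set.singleton_subset_iff.mpr h)
      rw [h1]
      exact (hT.dp_bot s x x' hN).trans (mul_le_mul_left hexp _)
    · have h1 : S ∩ {none} = ∅ := Set.inter_singleton_eq_empty.mpr h
      rw [h1]
      simp
  rw [← measure_inter_add_diff (μ := T x (some s)) S hn]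
  by_cases hG : s ∈ G x
  · have h2 := hT.good x s hG x' hN _ hP
    rw [← hdiff] at h2
    calc _ ≤ _ := add_le_add hbot h2
      _ = ENNReal.ofReal (Real.exp (2 * ε)) * T x' (some s) S := by
        rw [← mul_add, measure_inter_add_diff S hn]
      _ ≤ _ := le_self_add
  · refine add_le_add (hbot.trans ?_) ((measure_mono ?_).trans (hT.bad x s hG))
    · gcongr
      exact Set.inter_subset_left
    · exact fun o ho => ho.2
end

section
/- Let M^D_1 and M^D_2 be mechanisms with independent randomness and output space ℝ ∪ {⊥} such that for all neighboring databases x, x' and j = 1,2, Pr(M^D_j(x) = ⊥) ≤ e^ε · Pr(M^D_j(x') = ⊥). Let M_IQR be the mechanism that first runs M^D_1 and returns its output if it is not ⊥, and otherwise runs M^D_2 and returns its output. Assume M_IQR is (3ε, δ)-differentially private. Let P_1 = ℝ, P_2 = {⊥}, E(P_1) = 3ε, E(P_2) = 2ε. Then M_IQR is ({P_1, P_2}, E, δ)-output differentially private. -/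
open MeasureTheory
open scoped ENNReal NNReal

/-- The mechanism `M_IQR` built from `M₁ = M^D_1` and `M₂ = M^D_2` (with independent
randomness, output space `ℝ ∪ {⊥}` where `⊥ = none`): first run `M₁` and return its
output if it is not `⊥`; otherwise run `M₂` and return its output. -/
noncomputable def MIQR {D : Type*} (M₁ M₂ : D → Measure (Option ℝ)) (x : D) :
    Measure (Option ℝ) :=
  (M₁ x).bind fun r =>
    match r with
    | some v => Measure.dirac (some v)
    | none => M₂ x

theorem measurableSet_none_aux : MeasurableSet ({none} : Set (Option ℝ)) := by
  change MeasurableSet (some ⁻¹' ({none} : Set (Option ℝ)))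
  have : (some ⁻¹' ({none} : Set (Option ℝ)) : Set ℝ) = ∅ := by ext; simp
  rw [this]
  exact MeasurableSet.empty

theorem miqr_none_aux {D : Type*} (M₁ M₂ : D → Measure (Option ℝ)) (x : D) :
    MIQR M₁ M₂ x {none} = M₁ x {none} * M₂ x {none} := by
  have hsome : Measurable (some : ℝ → Option ℝ) := fun s hs => hs
  unfold MIQR
  rw [Measure.bind_apply measurableSet_none_aux]
  · have : ∀ r : Option ℝ, ((match r with
        | some v => Measure.dirac (some v)
        | none => M₂ x : Measure (Option ℝ)) {none})
        = ({none} : Set (Option ℝ)).indicator (fun _ => M₂ x {none}) r := by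
      intro r
      cases r with
      | none => simp
      | some v => simp [Measure.dirac_apply' _ measurableSet_none_aux]
    rw [lintegral_congr this, lintegral_indicator_const measurableSet_none_aux, mul_comm]
  · apply Measurable.aemeasurable
    intro s hs
    exact (Measure.measurable_dirac.comp hsome) hs

/-- if `Pr(M^D_j(x) = ⊥) ≤ e^ε Pr(M^D_j(x') = ⊥)` for `j = 1,2` and all
neighboring `x, x'`, and `M_IQR` is `(3ε,δ)`-DP, then `M_IQR` is
`({ℝ, {⊥}}, E, δ)`-ODP with `E(ℝ) = 3ε` and `E({⊥}) = 2ε`. -/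
theorem miqr_odp {D : Type*} (N : D → D → Prop)
    (M₁ M₂ : D → Measure (Option ℝ))
    [∀ x, IsProbabilityMeasure (M₁ x)] [∀ x, IsProbabilityMeasure (M₂ x)]
    (ε : ℝ) (hε : 0 ≤ ε) (δ : ℝ≥0∞)
    (hbot₁ : ∀ x x', N x x' →
      M₁ x {none} ≤ ENNReal.ofReal (Real.exp ε) * M₁ x' {none})
    (hbot₂ : ∀ x x', N x x' →
      M₂ x {none} ≤ ENNReal.ofReal (Real.exp ε) * M₂ x' {none})
    (hDP : IsDP N (MIQR M₁ M₂) (3 * ε) δ) :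
    ∀ x x', N x x' → ∀ S : Set (Option ℝ), MeasurableSet S →
      MIQR M₁ M₂ x S ≤ δ +
        (ENNReal.ofReal (Real.exp (3 * ε)) * MIQR M₁ M₂ x' (S ∩ {o | o ≠ none}) +
         ENNReal.ofReal (Real.exp (2 * ε)) * MIQR M₁ M₂ x' (S ∩ {none})) := by
  intro x x' hN S hS
  have hn := measurableSet_none_aux
  have hc : {o : Option ℝ | o ≠ none} = {none}ᶜ := by ext; simp
  have hadd : MIQR M₁ M₂ x S ≤
      MIQR M₁ M₂ x (S ∩ {o | o ≠ none}) + MIQR M₁ M₂ x (S ∩ {none}) := by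
    rw [hc, add_comm, ← Set.diff_eq, measure_inter_add_diff _ hn]
  have h1 := hDP x x' hN (S ∩ {o | o ≠ none}) (by rw [hc]; exact hS.inter hn.compl)
  have h2 : MIQR M₁ M₂ x (S ∩ {none}) ≤
      ENNReal.ofReal (Real.exp (2 * ε)) * MIQR M₁ M₂ x' (S ∩ {none}) := by
    by_cases h : none ∈ S
    · rw [Set.inter_eq_right.mpr (Set.singleton_subset_iff.mpr h), miqr_none_aux, miqr_none_aux]
      calc _ ≤ _ := mul_le_mul' (hbot₁ x x' hN) (hbot₂ x x' hN)
        _ = _ := by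
          rw [two_mul, Real.exp_add, ENNReal.ofReal_mul (Real.exp_pos _).le]
          ring
    · rw [Set.inter_singleton_eq_empty.mpr h]
      simp
  calc _ ≤ _ := hadd
    _ ≤ _ := add_le_add h1 h2
    _ = _ := by ring
end

section
/- For ε, δ ≥ 0, let the randomized response mechanism M̃_{(ε,δ)} : {0,1} → {0,1,2,3} be defined by Pr(M̃(0)=0) = δ, Pr(M̃(0)=1) = (1−δ)e^ε/(1+e^ε), Pr(M̃(0)=2) = (1−δ)/(1+e^ε), Pr(M̃(0)=3) = 0, and Pr(M̃(1)=0) = 0, Pr(M̃(1)=1) = (1−δ)/(1+e^ε), Pr(M̃(1)=2) = (1−δ)e^ε/(1+e^ε), Pr(M̃(1)=3) = δ. Then for any (ε,δ)-differentially private mechanism M and any pair of neighboring databases x^0, x^1, there exists a randomized function (Markov kernel) T from {0,1,2,3} to the output space of M such that T(M̃_{(ε,δ)}(b)) is identically distributed to M(x^b) for b = 0, 1. -/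
open MeasureTheory ProbabilityTheory
open scoped ENNReal NNReal

/-- The randomized response mechanism `M̃_{(ε,δ)} : {0,1} → {0,1,2,3}` of Kairouz,
Oh and Viswanath: `Pr(M̃(0)=0) = δ`, `Pr(M̃(0)=1) = (1−δ)e^ε/(1+e^ε)`,
`Pr(M̃(0)=2) = (1−δ)/(1+e^ε)`, `Pr(M̃(0)=3) = 0`, and `Pr(M̃(1)=0) = 0`,
`Pr(M̃(1)=1) = (1−δ)/(1+e^ε)`, `Pr(M̃(1)=2) = (1−δ)e^ε/(1+e^ε)`, `Pr(M̃(1)=3) = δ`. -/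
noncomputable def rrMeasure (ε δ : ℝ) (b : Bool) : Measure (Fin 4) :=
  if b then
    ENNReal.ofReal ((1 - δ) / (1 + Real.exp ε)) • Measure.dirac 1 +
    ENNReal.ofReal ((1 - δ) * Real.exp ε / (1 + Real.exp ε)) • Measure.dirac 2 +
    ENNReal.ofReal δ • Measure.dirac 3
  else
    ENNReal.ofReal δ • Measure.dirac 0 +
    ENNReal.ofReal ((1 - δ) * Real.exp ε / (1 + Real.exp ε)) • Measure.dirac 1 +
    ENNReal.ofReal ((1 - δ) / (1 + Real.exp ε)) • Measure.dirac 2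


namespace RR

variable {O : Type*} [MeasurableSpace O]

lemma normalize (ν P : Measure O) [IsProbabilityMeasure P] (c : ℝ≥0∞) (hc : c ≠ ⊤)
    (h : ν Set.univ = c) : ∃ A : Measure O, IsProbabilityMeasure A ∧ ν = c • A := by
  by_cases h0 : c = 0
  · refine ⟨P, inferInstance, ?_⟩
    rw [h0, zero_smul]
    exact Measure.measure_univ_eq_zero.mp (h.trans h0)
  · refine ⟨c⁻¹ • ν, ⟨?_⟩, ?_⟩
    · simp [h, ENNReal.inv_mul_cancel h0 hc]
    · rw [smul_smul, ENNReal.mul_inv_cancel h0 hc, one_smul]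

lemma interp (m P : Measure O) [IsFiniteMeasure P] [IsFiniteMeasure m] (hm : m ≤ P) (k : ℝ≥0∞)
    (h1 : m Set.univ ≤ k) (h2 : k ≤ P Set.univ) :
    ∃ R : Measure O, m ≤ R ∧ R ≤ P ∧ R Set.univ = k := by
  have hs : P - m + m = P := Measure.sub_add_cancel_of_le hm
  set W := P - m with hW
  have hWu : W Set.univ + m Set.univ = P Set.univ := by rw [← hs]; simp
  have hkW : k - m Set.univ ≤ W Set.univ := by
    rw [tsub_le_iff_right, hWu]; exact h2
  have hWfin : W Set.univ ≠ ⊤ := measure_ne_top _ _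
  refine ⟨((k - m Set.univ) / W Set.univ) • W + m, ?_, ?_, ?_⟩
  · exact Measure.le_add_left le_rfl
  · conv_rhs => rw [← hs]
    refine add_le_add ?_ le_rfl
    have : (k - m Set.univ) / W Set.univ ≤ 1 := by
      apply ENNReal.div_le_of_le_mul; simpa using hkW
    intro s
    simp only [Measure.smul_apply, smul_eq_mul]
    calc _ ≤ 1 * W s := by gcongr
      _ = W s := one_mul _
  · simp only [Measure.add_apply, Measure.smul_apply, smul_eq_mul]
    rw [ENNReal.div_mul_cancel', tsub_add_cancel_of_le h1]
    · intro h; simpa [h] using hkW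
    · intro h; exact absurd h hWfin

lemma inf_mass (P Q : Measure O) [IsProbabilityMeasure P] [IsProbabilityMeasure Q]
    (E : ℝ≥0∞) (d : ℝ≥0∞)
    (h : ∀ S : Set O, MeasurableSet S → P S ≤ E * Q S + d) :
    1 - d ≤ (P ⊓ E • Q) Set.univ := by
  rw [Measure.inf_apply MeasurableSet.univ]
  apply le_sInf
  rintro _ ⟨t, rfl⟩
  rw [tsub_le_iff_right]
  simp only [Set.inter_univ, Measure.smul_apply, smul_eq_mul]
  calc (1 : ℝ≥0∞) = P Set.univ := measure_univ.symm
    _ ≤ P (t ∪ toMeasurable Q tᶜ) := by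
        apply measure_mono
        intro x _
        by_cases hx : x ∈ t
        · exact Or.inl hx
        · exact Or.inr (subset_toMeasurable Q _ hx)
    _ ≤ P t + P (toMeasurable Q tᶜ) := measure_union_le _ _
    _ ≤ P t + (E * Q (toMeasurable Q tᶜ) + d) := by
        gcongr; exact h _ (measurableSet_toMeasurable _ _)
    _ = P t + E * Q tᶜ + d := by rw [measure_toMeasurable, add_assoc]

lemma smul_le_of_one_le (P : Measure O) (E : ℝ≥0∞) (hE : 1 ≤ E) : P ≤ E • P := by
  intro s
  simp only [Measure.smul_apply, smul_eq_mul]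
  calc P s = 1 * P s := (one_mul _).symm
    _ ≤ _ := by gcongr

lemma le_smul_inf (P Q R : Measure O) (E : ℝ≥0∞) (h0 : E ≠ 0) (ht : E ≠ ⊤)
    (h1 : R ≤ E • P) (h2 : R ≤ E • Q) : R ≤ E • (P ⊓ Q) := by
  have key : ∀ X Y : Measure O, X ≤ E • Y → E⁻¹ • X ≤ Y := by
    intro X Y h s
    have := h s
    simp only [Measure.smul_apply, smul_eq_mul] at this ⊢
    calc E⁻¹ * X s ≤ E⁻¹ * (E * Y s) := by gcongr
      _ = Y s := by rw [← mul_assoc, ENNReal.inv_mul_cancel h0 ht, one_mul]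
  have h3 : E⁻¹ • R ≤ P ⊓ Q := le_inf (key _ _ h1) (key _ _ h2)
  intro s
  have := h3 s
  simp only [Measure.smul_apply, smul_eq_mul] at this ⊢
  calc R s = E * (E⁻¹ * R s) := by rw [← mul_assoc, ENNReal.mul_inv_cancel h0 ht, one_mul]
    _ ≤ _ := by gcongr

lemma smul_mono (P Q : Measure O) (E : ℝ≥0∞) (h : P ≤ Q) : E • P ≤ E • Q := by
  intro s
  have := h s
  simp only [Measure.smul_apply, smul_eq_mul]
  gcongr

lemma core (P Q : Measure O) [IsProbabilityMeasure P] [IsProbabilityMeasure Q]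
    (E : ℝ≥0∞) (hE : 1 ≤ E) (ht : E ≠ ⊤) (d : ℝ≥0∞)
    (h : ∀ S : Set O, MeasurableSet S → P S ≤ E * Q S + d)
    (h' : ∀ S : Set O, MeasurableSet S → Q S ≤ E * P S + d) :
    ∃ P' Q' : Measure O, P' ≤ P ∧ Q' ≤ Q ∧ P' ≤ E • Q' ∧ Q' ≤ E • P' ∧
      P' Set.univ = 1 - d ∧ Q' Set.univ = 1 - d := by
  have h0 : E ≠ 0 := (lt_of_lt_of_le one_pos hE).ne'
  have : IsFiniteMeasure (P ⊓ Q) := isFiniteMeasure_of_le P inf_le_left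
  have : IsFiniteMeasure (P ⊓ E • Q) := isFiniteMeasure_of_le P inf_le_left
  have : IsFiniteMeasure (Q ⊓ E • P) := isFiniteMeasure_of_le Q inf_le_left
  rcases le_total ((P ⊓ Q) Set.univ) (1 - d) with hk | hk
  · obtain ⟨P', a1, a2, a3⟩ := interp (P ⊓ Q) (P ⊓ E • Q)
      (le_inf inf_le_left (inf_le_right.trans (smul_le_of_one_le Q E hE))) _ hk (inf_mass P Q E d h)
    obtain ⟨Q', b1, b2, b3⟩ := interp (P ⊓ Q) (Q ⊓ E • P)
      (le_inf inf_le_right (inf_le_left.trans (smul_le_of_one_le P E hE))) _ hk (inf_mass Q P E d h')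
    refine ⟨P', Q', a2.trans inf_le_left, b2.trans inf_le_left, ?_, ?_, a3, b3⟩
    · refine le_trans ?_ (smul_mono _ _ E b1)
      exact le_smul_inf _ _ _ E h0 ht ((a2.trans inf_le_left).trans (smul_le_of_one_le P E hE))
        (a2.trans inf_le_right)
    · refine le_trans ?_ (smul_mono _ _ E a1)
      exact le_smul_inf _ _ _ E h0 ht (b2.trans inf_le_right)
        ((b2.trans inf_le_left).trans (smul_le_of_one_le Q E hE))
  · obtain ⟨R, -, r2, r3⟩ := interp 0 (P ⊓ Q) (Measure.zero_le _) (1 - d) (by simp) hk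
    exact ⟨R, R, r2.trans inf_le_left, r2.trans inf_le_right, smul_le_of_one_le R E hE,
      smul_le_of_one_le R E hE, r3, r3⟩

lemma split (P Q : Measure O) [IsFiniteMeasure P] [IsFiniteMeasure Q]
    (e : ℝ) (he : 1 ≤ e) (k : ℝ≥0∞)
    (h : P ≤ ENNReal.ofReal e • Q) (h' : Q ≤ ENNReal.ofReal e • P)
    (hP : P Set.univ = k) (hQ : Q Set.univ = k) :
    ∃ B C : Measure O, B Set.univ = k ∧ C Set.univ = k ∧
      P = ENNReal.ofReal (e / (1 + e)) • B + ENNReal.ofReal (1 / (1 + e)) • C ∧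
      Q = ENNReal.ofReal (1 / (1 + e)) • B + ENNReal.ofReal (e / (1 + e)) • C := by
  rcases he.eq_or_lt with rfl | he1
  · simp only [ENNReal.ofReal_one, one_smul] at h h'
    obtain rfl := le_antisymm h h'
    have : P = ENNReal.ofReal (1 / (1 + 1)) • P + ENNReal.ofReal (1 / (1 + 1)) • P := by
      rw [← add_smul, ← ENNReal.ofReal_add (by positivity) (by positivity)]
      norm_num
    exact ⟨P, P, hP, hP, this, this⟩
  have hU : ENNReal.ofReal e • P - Q + Q = ENNReal.ofReal e • P := Measure.sub_add_cancel_of_le h'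
  have hV : ENNReal.ofReal e • Q - P + P = ENNReal.ofReal e • Q := Measure.sub_add_cancel_of_le h
  have fP : IsFiniteMeasure (ENNReal.ofReal e • P) := P.smul_finite ENNReal.ofReal_ne_top
  have fQ : IsFiniteMeasure (ENNReal.ofReal e • Q) := Q.smul_finite ENNReal.ofReal_ne_top
  set U := ENNReal.ofReal e • P - Q
  set V := ENNReal.ofReal e • Q - P
  have e0 : 0 ≤ e := by linarith
  have e1 : 0 < e - 1 := by linarith
  have e2 : 0 < e + 1 := by linarith
  have rU : ∀ s, U.real s + Q.real s = e * P.real s := by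
    intro s
    have := congrArg (fun μ : Measure O => (μ s).toReal) hU
    simp only [Measure.add_apply, Measure.smul_apply, smul_eq_mul, ENNReal.toReal_mul,
      ENNReal.toReal_ofReal e0] at this
    rwa [ENNReal.toReal_add (measure_ne_top _ _) (measure_ne_top _ _)] at this
  have rV : ∀ s, V.real s + P.real s = e * Q.real s := by
    intro s
    have := congrArg (fun μ : Measure O => (μ s).toReal) hV
    simp only [Measure.add_apply, Measure.smul_apply, smul_eq_mul, ENNReal.toReal_mul,
      ENNReal.toReal_ofReal e0] at this
    rwa [ENNReal.toReal_add (measure_ne_top _ _) (measure_ne_top _ _)] at this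
  have hPQ : P.real Set.univ = Q.real Set.univ := by simp [Measure.real, hP, hQ]
  refine ⟨ENNReal.ofReal (1 / (e - 1)) • U, ENNReal.ofReal (1 / (e - 1)) • V, ?_, ?_, ?_, ?_⟩
  · rw [← hP]
    simp only [Measure.smul_apply, smul_eq_mul]
    rw [← ofReal_measureReal (μ := U), ← ofReal_measureReal (μ := P),
      ← ENNReal.ofReal_mul (by positivity)]
    congr 1
    have := rU Set.univ
    field_simp
    linarith
  · rw [← hQ]
    simp only [Measure.smul_apply, smul_eq_mul]
    rw [← ofReal_measureReal (μ := V), ← ofReal_measureReal (μ := Q),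
      ← ENNReal.ofReal_mul (by positivity)]
    congr 1
    have := rV Set.univ
    field_simp
    linarith
  · ext s _
    simp only [Measure.add_apply, Measure.smul_apply, smul_eq_mul]
    rw [← ofReal_measureReal (μ := U), ← ofReal_measureReal (μ := V),
      ← ofReal_measureReal (μ := P), ← ENNReal.ofReal_mul (by positivity),
      ← ENNReal.ofReal_mul (by positivity), ← ENNReal.ofReal_mul (by positivity),
      ← ENNReal.ofReal_mul (by positivity), ← ENNReal.ofReal_add (by positivity) (by positivity)]
    congr 1
    have u := rU s
    have v := rV s
    rw [show U.real s = e * P.real s - Q.real s by linarith,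
      show V.real s = e * Q.real s - P.real s by linarith]
    field_simp
    ring
  · ext s _
    simp only [Measure.add_apply, Measure.smul_apply, smul_eq_mul]
    rw [← ofReal_measureReal (μ := U), ← ofReal_measureReal (μ := V),
      ← ofReal_measureReal (μ := Q), ← ENNReal.ofReal_mul (by positivity),
      ← ENNReal.ofReal_mul (by positivity), ← ENNReal.ofReal_mul (by positivity),
      ← ENNReal.ofReal_mul (by positivity), ← ENNReal.ofReal_add (by positivity) (by positivity)]
    congr 1
    have u := rU s
    have v := rV s
    rw [show U.real s = e * P.real s - Q.real s by linarith,
      show V.real s = e * Q.real s - P.real s by linarith]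
    field_simp
    ring

lemma rest (P P' : Measure O) [IsProbabilityMeasure P] (δ : ℝ) (h0 : 0 ≤ δ) (h1 : δ ≤ 1)
    (h : P' ≤ P) (hm : P' Set.univ = 1 - ENNReal.ofReal δ) :
    ∃ A : Measure O, IsProbabilityMeasure A ∧ P = ENNReal.ofReal δ • A + P' := by
  have : IsFiniteMeasure P' := isFiniteMeasure_of_le P h
  have hs : P - P' + P' = P := Measure.sub_add_cancel_of_le h
  have hd : ENNReal.ofReal δ ≤ 1 := by simpa using h1
  have hu : (P - P') Set.univ = ENNReal.ofReal δ := by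
    have := congrArg (fun μ : Measure O => μ Set.univ) hs
    simp only [Measure.add_apply, measure_univ, hm] at this
    have hne : 1 - ENNReal.ofReal δ ≠ ⊤ := ne_top_of_le_ne_top ENNReal.one_ne_top tsub_le_self
    refine (ENNReal.add_left_inj hne).mp ?_
    rw [this, add_tsub_cancel_of_le hd]
  obtain ⟨A, hA, hA'⟩ := normalize (P - P') P _ ENNReal.ofReal_ne_top hu
  exact ⟨A, hA, by rw [← hA', hs]⟩

end RR

/-- for any `(ε,δ)`-DP mechanism `M` and any pair of neighboring
databases `x⁰, x¹` there is a Markov kernel `T` from `{0,1,2,3}` to the output space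
of `M` such that `T(M̃_{(ε,δ)}(b))` is distributed as `M(x^b)` for `b = 0,1`. -/
theorem dp_mechanism_from_randomized_response {D O : Type*} [MeasurableSpace O]
    (N : D → D → Prop) (M : D → Measure O) [∀ x, IsProbabilityMeasure (M x)]
    (ε δ : ℝ) (hε : 0 ≤ ε) (hδ0 : 0 ≤ δ) (hδ1 : δ ≤ 1)
    (hDP : IsDP N M ε (ENNReal.ofReal δ))
    (x0 x1 : D) (hN : N x0 x1) (hN' : N x1 x0) :
    ∃ T : Kernel (Fin 4) O, IsMarkovKernel T ∧
      (rrMeasure ε δ false).bind (fun i => T i) = M x0 ∧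
      (rrMeasure ε δ true).bind (fun i => T i) = M x1 := by
  set e := Real.exp ε with he
  have he1 : 1 ≤ e := Real.one_le_exp hε
  have hE : 1 ≤ ENNReal.ofReal e := by simpa using he1
  obtain ⟨P, Q, hP, hQ, hPQ, hQP, mP, mQ⟩ := RR.core (M x0) (M x1) (ENNReal.ofReal e) hE
    ENNReal.ofReal_ne_top (ENNReal.ofReal δ) (hDP x0 x1 hN) (hDP x1 x0 hN')
  have fP : IsFiniteMeasure P := isFiniteMeasure_of_le _ hP
  have fQ : IsFiniteMeasure Q := isFiniteMeasure_of_le _ hQ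
  obtain ⟨A, hA, eA⟩ := RR.rest (M x0) P δ hδ0 hδ1 hP mP
  obtain ⟨F, hF, eF⟩ := RR.rest (M x1) Q δ hδ0 hδ1 hQ mQ
  obtain ⟨B', C', mB, mC, eP, eQ⟩ := RR.split P Q e he1 _ hPQ hQP mP mQ
  have hk : 1 - ENNReal.ofReal δ = ENNReal.ofReal (1 - δ) := by
    rw [ENNReal.ofReal_sub _ hδ0, ENNReal.ofReal_one]
  rw [hk] at mB mC
  obtain ⟨B, hB, rfl⟩ := RR.normalize B' (M x0) _ ENNReal.ofReal_ne_top mB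
  obtain ⟨C, hC, rfl⟩ := RR.normalize C' (M x0) _ ENNReal.ofReal_ne_top mC
  have c1 : ENNReal.ofReal ((1 - δ) / (1 + e)) =
      ENNReal.ofReal (1 / (1 + e)) * ENNReal.ofReal (1 - δ) := by
    rw [← ENNReal.ofReal_mul (by positivity)]; congr 1; ring
  have c2 : ENNReal.ofReal ((1 - δ) * e / (1 + e)) =
      ENNReal.ofReal (e / (1 + e)) * ENNReal.ofReal (1 - δ) := by
    rw [← ENNReal.ofReal_mul (by positivity)]; congr 1; ring
  let T : Kernel (Fin 4) O := ⟨![A, B, C, F], measurable_of_countable _⟩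
  have T0 : T 0 = A := rfl
  have T1 : T 1 = B := rfl
  have T2 : T 2 = C := rfl
  have T3 : T 3 = F := rfl
  refine ⟨T, ⟨?_⟩, ?_, ?_⟩
  · intro i
    fin_cases i
    · exact hA
    · exact hB
    · exact hC
    · exact hF
  · rw [eA, eP]
    ext s hs
    rw [Measure.bind_apply hs T.measurable.aemeasurable]
    simp only [rrMeasure, ← he, c1, c2, Bool.false_eq_true, if_false, lintegral_add_measure,
      lintegral_smul_measure, lintegral_dirac, T0, T1, T2, Measure.add_apply, Measure.smul_apply,
      smul_eq_mul]
    ring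
  · rw [eF, eQ]
    ext s hs
    rw [Measure.bind_apply hs T.measurable.aemeasurable]
    simp only [rrMeasure, ← he, c1, c2, if_true, lintegral_add_measure,
      lintegral_smul_measure, lintegral_dirac, T1, T2, T3, Measure.add_apply, Measure.smul_apply,
      smul_eq_mul]
    ring
end
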